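/- Let φ = p̃/p be a bidegree (m,n) rational inner function on 𝔻², let τ₁,…,τ_K ∈ 𝕋 denote the z₁-coordinates of the singularities of φ on 𝕋², let 0 < ε̂ < (1/2)min{|τ_k − τ_j| : j ≠ k}, and set S_ε̂ = {ζ ∈ 𝕋 : min_{1≤k≤K} |ζ − τ_k| < ε̂}. Then for every continuous function f on 𝕋², the function F(ζ, α) = ∑_{j=1}^n f(ζ, g_j^α(ζ)) |∂φ/∂z₂(ζ, g_j^α(ζ))|^{-1} is uniformly continuous on (𝕋∖S_ε̂) × 𝕋, where g₁^α,…,g_n^α are the parameterizing functions for C_α(φ). -/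

import Mathlib

open MeasureTheory Complex Filter Topology

noncomputable section

/-- The open unit bidisk `𝔻²` in `ℂ²`. -/
def bidisk : Set (ℂ × ℂ) := {z | ‖z.1‖ < 1 ∧ ‖z.2‖ < 1}

/-- The closed bidisk. -/
def closedBidisk : Set (ℂ × ℂ) := {z | ‖z.1‖ ≤ 1 ∧ ‖z.2‖ ≤ 1}

/-- The distinguished boundary `𝕋²` of the bidisk. -/
def torus2 : Set (ℂ × ℂ) := {z | ‖z.1‖ = 1 ∧ ‖z.2‖ = 1}

/-- Evaluation of a two-variable polynomial at a point of `ℂ²`. -/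
def ev (p : MvPolynomial (Fin 2) ℂ) (z : ℂ × ℂ) : ℂ :=
  MvPolynomial.eval ![z.1, z.2] p

/-- The rational function `φ = p̃/p`. -/
def rif (p pt : MvPolynomial (Fin 2) ℂ) (z : ℂ × ℂ) : ℂ := ev pt z / ev p z

/-- The partial derivative `∂φ/∂z₁` of `φ = p̃/p`, via the quotient rule. -/
def dphi1 (p pt : MvPolynomial (Fin 2) ℂ) (z : ℂ × ℂ) : ℂ :=
  (ev (MvPolynomial.pderiv 0 pt) z * ev p z - ev pt z * ev (MvPolynomial.pderiv 0 p) z) /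
    (ev p z) ^ 2

/-- The partial derivative `∂φ/∂z₂` of `φ = p̃/p`, via the quotient rule. -/
def dphi2 (p pt : MvPolynomial (Fin 2) ℂ) (z : ℂ × ℂ) : ℂ :=
  (ev (MvPolynomial.pderiv 1 pt) z * ev p z - ev pt z * ev (MvPolynomial.pderiv 1 p) z) /
    (ev p z) ^ 2

/-- `pt` is the reflection `p̃(z₁,z₂) = z₁^m z₂^n conj(p(1/conj z₁, 1/conj z₂))` of `p`
at bidegree `(m,n)`. -/
def IsReflection2 (m n : ℕ) (p pt : MvPolynomial (Fin 2) ℂ) : Prop :=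
  ∀ z : ℂ × ℂ, z.1 ≠ 0 → z.2 ≠ 0 →
    ev pt z = z.1 ^ m * z.2 ^ n *
      (starRingEnd ℂ) (ev p (((starRingEnd ℂ) z.1)⁻¹, ((starRingEnd ℂ) z.2)⁻¹))

/-- The data of a bidegree `(m,n)` rational inner function `φ = p̃/p` on the bidisk
(with `m, n ≥ 1`):  `p` has degree `m` in `z₁` and `n` in `z₂`, is zero-free on `𝔻²`,
and has no common factor with its reflection `p̃`. -/
structure IsRIF2 (m n : ℕ) (p pt : MvPolynomial (Fin 2) ℂ) : Prop where
  hm : 1 ≤ m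
  hn : 1 ≤ n
  deg1 : MvPolynomial.degreeOf 0 p = m
  deg2 : MvPolynomial.degreeOf 1 p = n
  stable : ∀ z ∈ bidisk, ev p z ≠ 0
  coprime : ∀ r : MvPolynomial (Fin 2) ℂ, r ∣ p → r ∣ pt → IsUnit r
  reflection : IsReflection2 m n p pt

/-- The unimodular level set `C_α(φ)`, the closure of the set of points of `𝕋²` where
the radial limit of `φ` equals `α`. -/
def levelSet2 (p pt : MvPolynomial (Fin 2) ℂ) (α : ℂ) : Set (ℂ × ℂ) :=
  closure {ζ | ζ ∈ torus2 ∧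
    Tendsto (fun r : ℝ => rif p pt ((r : ℂ) * ζ.1, (r : ℂ) * ζ.2))
      (𝓝[<] (1 : ℝ)) (𝓝 α)}

/-- `α` is an exceptional value for `φ = p̃/p`: some horizontal or vertical line of `𝕋²`
is contained in `C_α(φ)`. -/
def IsExceptional (p pt : MvPolynomial (Fin 2) ℂ) (α : ℂ) : Prop :=
  ∃ τ : ℂ, ‖τ‖ = 1 ∧
    ({ζ : ℂ × ℂ | ζ.1 = τ ∧ ‖ζ.2‖ = 1} ⊆ levelSet2 p pt α ∨
     {ζ : ℂ × ℂ | ‖ζ.1‖ = 1 ∧ ζ.2 = τ} ⊆ levelSet2 p pt α)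

/-- `α` is a generic value for `φ = p̃/p`. -/
def IsGenericValue (p pt : MvPolynomial (Fin 2) ℂ) (α : ℂ) : Prop :=
  ¬ IsExceptional p pt α

/-- Normalized Lebesgue (arclength) measure on the unit circle, as a measure on `ℂ`. -/
def mCircle : Measure ℂ :=
  (ENNReal.ofReal (2 * Real.pi))⁻¹ •
    Measure.map (fun θ : ℝ => Complex.exp ((θ : ℂ) * Complex.I))
      (MeasureTheory.volume.restrict (Set.Ico 0 (2 * Real.pi)))

/-- The two-variable product Poisson kernel. -/
def poisson2 (z ζ : ℂ × ℂ) : ℝ :=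
  ((1 - ‖z.1‖ ^ 2) / ‖ζ.1 - z.1‖ ^ 2) * ((1 - ‖z.2‖ ^ 2) / ‖ζ.2 - z.2‖ ^ 2)

/-- `σ` is the Clark measure of `φ = p̃/p` at parameter `α`: a positive Borel measure
on `𝕋²` whose Poisson integral is `(1-|φ(z)|²)/|α-φ(z)|²`. -/
def IsClarkMeasure2 (p pt : MvPolynomial (Fin 2) ℂ) (α : ℂ) (σ : Measure (ℂ × ℂ)) : Prop :=
  σ torus2ᶜ = 0 ∧
  ∀ z ∈ bidisk,
    ∫⁻ ζ, ENNReal.ofReal (poisson2 z ζ) ∂σ =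
      ENNReal.ofReal ((1 - ‖rif p pt z‖ ^ 2) / ‖α - rif p pt z‖ ^ 2)

/-- `g₁, …, g_n : 𝕋 → 𝕋` are functions on the circle, analytic except possibly at one
base point `τ₀ ∈ 𝕋`. -/
def IsGraphFamily (n : ℕ) (g : Fin n → ℂ → ℂ) : Prop :=
  (∀ j, ∀ ζ : ℂ, ‖ζ‖ = 1 → ‖g j ζ‖ = 1) ∧
  ∃ τ₀ : ℂ, ‖τ₀‖ = 1 ∧ ∀ j, ∀ θ : ℝ,
    Complex.exp ((θ : ℂ) * Complex.I) ≠ τ₀ →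
      AnalyticAt ℝ (fun t : ℝ => g j (Complex.exp ((t : ℂ) * Complex.I))) θ

/-- The union of the graphs `{(ζ, g_j(ζ)) : ζ ∈ 𝕋}`. -/
def graphUnion (n : ℕ) (g : Fin n → ℂ → ℂ) : Set (ℂ × ℂ) :=
  ⋃ j, {w : ℂ × ℂ | ‖w.1‖ = 1 ∧ w.2 = g j w.1}

/-- The vertical line `{ζ ∈ 𝕋² : ζ₁ = τ}`. -/
def vLine (τ : ℂ) : Set (ℂ × ℂ) := {w : ℂ × ℂ | w.1 = τ ∧ ‖w.2‖ = 1}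

section OneVar
open Polynomial

lemma re_inner {w b : ℂ} (hw : ‖w‖ = 1) (hb : ‖b‖ < 1) : (1 / 2 : ℝ) < (w * (1 / (w - b))).re := by
  have hne : w - b ≠ 0 := by
    intro h; rw [sub_eq_zero] at h; rw [h] at hw; linarith
  have hpos : 0 < Complex.normSq (w - b) := Complex.normSq_pos.2 hne
  have h1 : Complex.normSq w = 1 := by rw [Complex.normSq_eq_norm_sq, hw]; norm_num
  have h2 : Complex.normSq b < 1 := by
    rw [Complex.normSq_eq_norm_sq]; nlinarith [norm_nonneg b]
  have e : (w * (1 / (w - b))).re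
      = (w.re * (w - b).re + w.im * (w - b).im) / Complex.normSq (w - b) := by
    rw [mul_one_div, Complex.div_re]; ring
  rw [e, lt_div_iff₀ hpos]
  simp only [Complex.normSq_apply, Complex.sub_re, Complex.sub_im] at *
  nlinarith

lemma re_outer {w b : ℂ} (hw : ‖w‖ = 1) (hb : 1 < ‖b‖) : (w * (1 / (w - b))).re ≤ (1 / 2 : ℝ) := by
  have hne : w - b ≠ 0 := by
    intro h; rw [sub_eq_zero] at h; rw [h] at hw; linarith
  have hpos : 0 < Complex.normSq (w - b) := Complex.normSq_pos.2 hne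
  have h1 : Complex.normSq w = 1 := by rw [Complex.normSq_eq_norm_sq, hw]; norm_num
  have h2 : 1 < Complex.normSq b := by
    rw [Complex.normSq_eq_norm_sq]; nlinarith [norm_nonneg b]
  have e : (w * (1 / (w - b))).re
      = (w.re * (w - b).re + w.im * (w - b).im) / Complex.normSq (w - b) := by
    rw [mul_one_div, Complex.div_re]; ring
  rw [e, div_le_iff₀ hpos]
  simp only [Complex.normSq_apply, Complex.sub_re, Complex.sub_im] at *
  nlinarith

lemma rsum_inner {w : ℂ} (hw : ‖w‖ = 1) (s : Multiset ℂ) (hs : ∀ b ∈ s, ‖b‖ < 1) :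
    (s.card : ℝ) / 2 ≤ (w * (s.map fun z => 1 / (w - z)).sum).re ∧
    (0 < s.card → (s.card : ℝ) / 2 < (w * (s.map fun z => 1 / (w - z)).sum).re) := by
  induction s using Multiset.induction_on with
  | empty => simp
  | cons a s ih =>
    have h1 := re_inner hw (hs a (by simp))
    have h2 := (ih (fun b hb => hs b (by simp [hb]))).1
    simp only [Multiset.card_cons, Multiset.map_cons, Multiset.sum_cons, mul_add, Complex.add_re]
    push_cast
    constructor
    · linarith
    · intro _; linarith

lemma rsum_outer {w : ℂ} (hw : ‖w‖ = 1) (s : Multiset ℂ) (hs : ∀ b ∈ s, 1 < ‖b‖) :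
    (w * (s.map fun z => 1 / (w - z)).sum).re ≤ (s.card : ℝ) / 2 := by
  induction s using Multiset.induction_on with
  | empty => simp
  | cons a s ih =>
    have h1 := re_outer hw (hs a (by simp))
    have h2 := ih (fun b hb => hs b (by simp [hb]))
    simp only [Multiset.card_cons, Multiset.map_cons, Multiset.sum_cons, mul_add, Complex.add_re]
    push_cast
    linarith

/-- Slice data. -/
structure Slice (n : ℕ) (c : ℂ) (q qt : ℂ[X]) : Prop where
  hn : 1 ≤ n
  hc : ‖c‖ = 1
  hq : q.natDegree ≤ n
  refl : ∀ w : ℂ, w ≠ 0 →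
    qt.eval w = c * w ^ n * (starRingEnd ℂ) (q.eval ((starRingEnd ℂ) w)⁻¹)
  nz : ∀ w : ℂ, ‖w‖ ≤ 1 → q.eval w ≠ 0

variable {n : ℕ} {c : ℂ} {q qt : ℂ[X]}

lemma Slice.qt_eq (h : Slice n c q qt) : qt = C c * reflect n (q.map (starRingEnd ℂ)) := by
  apply Polynomial.eq_of_infinite_eval_eq
  refine Set.Infinite.mono (s := {0}ᶜ) ?_ (Set.finite_singleton _).infinite_compl
  intro w hw
  have hw : w ≠ 0 := hw
  have hw' : w⁻¹ ≠ 0 := inv_ne_zero hw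
  let _ := invertibleOfNonzero hw'
  have h1 := eval₂_reflect_mul_pow (RingHom.id ℂ) (w⁻¹) n (q.map (starRingEnd ℂ))
    (natDegree_map_le.trans h.hq)
  simp only [invOf_eq_inv, inv_inv] at h1
  have h2 : eval₂ (RingHom.id ℂ) w⁻¹ (q.map (starRingEnd ℂ))
      = (starRingEnd ℂ) (q.eval ((starRingEnd ℂ) w)⁻¹) := by
    have : w⁻¹ = (starRingEnd ℂ) ((starRingEnd ℂ) w)⁻¹ := by simp
    rw [this, eval₂_id, eval_map_apply]
  rw [h2] at h1
  show eval w qt = eval w _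
  rw [h.refl w hw, ← h1, eval_mul, eval_C, ← eval₂_id]
  have : (w⁻¹) ^ n * w ^ n = 1 := by rw [← mul_pow, inv_mul_cancel₀ hw, one_pow]
  linear_combination (c * eval₂ (RingHom.id ℂ) w (reflect n (q.map (starRingEnd ℂ)))) * this

lemma Slice.qt_deg_le (h : Slice n c q qt) : qt.natDegree ≤ n := by
  rw [h.qt_eq]
  refine (natDegree_C_mul_le _ _).trans (natDegree_reflect_le.trans ?_)
  simp [h.hq]

lemma Slice.qt_coeff_n (h : Slice n c q qt) : qt.coeff n = c * (starRingEnd ℂ) (q.coeff 0) := by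
  rw [h.qt_eq]; simp [coeff_reflect, revAt_le]

lemma Slice.qt_coeff_zero (h : Slice n c q qt) : qt.coeff 0 = c * (starRingEnd ℂ) (q.coeff n) := by
  rw [h.qt_eq, coeff_C_mul, coeff_reflect, revAt_le (Nat.zero_le _)]; simp

lemma Slice.c_ne (h : Slice n c q qt) : c ≠ 0 := by
  have := h.hc; intro h0; simp [h0] at this

lemma Slice.q0_ne (h : Slice n c q qt) : q.coeff 0 ≠ 0 := by
  rw [coeff_zero_eq_eval_zero]; exact h.nz 0 (by simp)

lemma Slice.qt_deg (h : Slice n c q qt) : qt.natDegree = n := by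
  apply natDegree_eq_of_le_of_coeff_ne_zero h.qt_deg_le
  rw [h.qt_coeff_n]
  exact mul_ne_zero h.c_ne (by simpa using h.q0_ne)

lemma inv_conj_of_norm_one {w : ℂ} (hw : ‖w‖ = 1) : ((starRingEnd ℂ) w)⁻¹ = w := by
  rw [inv_eq_of_mul_eq_one_right]
  rw [mul_comm, Complex.mul_conj, Complex.normSq_eq_norm_sq, hw]; simp

lemma Slice.norm_circle (h : Slice n c q qt) {w : ℂ} (hw : ‖w‖ = 1) :
    ‖qt.eval w‖ = ‖q.eval w‖ := by
  have hw0 : w ≠ 0 := by intro h0; simp [h0] at hw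
  rw [h.refl w hw0, inv_conj_of_norm_one hw]
  simp [hw, h.hc]

lemma Slice.deriv_ne (h : Slice n c q qt) {w : ℂ} (hw : ‖w‖ = 1) :
    qt.derivative.eval w * q.eval w - qt.eval w * q.derivative.eval w ≠ 0 := by
  have hqw := h.nz w hw.le
  have hqtw : qt.eval w ≠ 0 := by
    rw [← norm_pos_iff, h.norm_circle hw]; exact norm_pos_iff.2 hqw
  have hq0 : q ≠ 0 := by rintro rfl; simp at hqw
  have hqt0 : qt ≠ 0 := by rintro rfl; simp at hqtw
  have s1 := IsAlgClosed.splits q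
  have s2 := IsAlgClosed.splits qt
  have c1 : q.roots.card ≤ n := (card_roots' q).trans h.hq
  have c2 : qt.roots.card = n := by rw [← s2.natDegree_eq_card_roots, h.qt_deg]
  have e1 := s1.eval_derivative_div_eval_of_ne_zero hqw
  have e2 := s2.eval_derivative_div_eval_of_ne_zero hqtw
  have b1 := rsum_outer hw q.roots (by
    intro b hb
    by_contra hcon
    exact h.nz b (not_lt.1 hcon) ((mem_roots hq0).1 hb))
  have b2 := (rsum_inner hw qt.roots (by
    intro b hb
    by_contra hcon
    have hb1 : 1 ≤ ‖b‖ := not_lt.1 hcon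
    have hb0 : b ≠ 0 := by rintro rfl; simp at hb1; linarith
    have : qt.eval b = 0 := (mem_roots hqt0).1 hb
    rw [h.refl b hb0] at this
    have hb' : q.eval ((starRingEnd ℂ) b)⁻¹ ≠ 0 := h.nz _ (by
      rw [norm_inv, RCLike.norm_conj]; exact inv_le_one_of_one_le₀ hb1)
    refine mul_ne_zero (mul_ne_zero h.c_ne (pow_ne_zero _ hb0)) ?_ this
    simpa using hb')).2 (by rw [c2]; exact h.hn)
  rw [← e1] at b1
  rw [← e2, c2] at b2
  intro h0
  have : qt.derivative.eval w / qt.eval w = q.derivative.eval w / q.eval w := by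
    rw [div_eq_div_iff hqtw hqw]; linear_combination h0
  rw [this] at b2
  have : (q.roots.card : ℝ) ≤ n := by exact_mod_cast c1
  linarith

lemma Slice.norm_disk (h : Slice n c q qt) {w : ℂ} (hw : ‖w‖ < 1) :
    ‖qt.eval w‖ < ‖q.eval w‖ := by
  set b : ℂ → ℂ := fun z => qt.eval z / q.eval z with hb
  have hcl : closure (Metric.ball (0 : ℂ) 1) = Metric.closedBall 0 1 :=
    closure_ball _ one_ne_zero
  have hd : DiffContOnCl ℂ b (Metric.ball 0 1) := by
    apply DifferentiableOn.diffContOnCl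
    rw [hcl]
    intro z hz
    have hz : ‖z‖ ≤ 1 := by simpa using hz
    exact ((qt.differentiableAt).div (q.differentiableAt) (h.nz z hz)).differentiableWithinAt
  have hle : ∀ z ∈ closure (Metric.ball (0 : ℂ) 1), ‖b z‖ ≤ 1 := by
    intro z hz
    refine Complex.norm_le_of_forall_mem_frontier_norm_le Metric.isBounded_ball hd ?_ hz
    intro z hz
    rw [frontier_ball _ one_ne_zero] at hz
    have hz : ‖z‖ = 1 := by simpa using hz
    simp only [hb, norm_div, h.norm_circle hz]
    exact div_self_le_one _
  have hqw : 0 < ‖q.eval w‖ := norm_pos_iff.2 (h.nz w hw.le)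
  have hwb : w ∈ Metric.ball (0 : ℂ) 1 := by simpa using hw
  have hbw := hle w (subset_closure hwb)
  rcases hbw.lt_or_eq with hlt | heq
  · simp only [hb, norm_div] at hlt
    rwa [div_lt_one hqw] at hlt
  · exfalso
    have key := Complex.eqOn_of_isPreconnected_of_isMaxOn_norm
      (convex_ball (0 : ℂ) 1).isPreconnected Metric.isOpen_ball hd.differentiableOn hwb (by
        intro z hz
        show ‖b z‖ ≤ ‖b w‖
        rw [heq]; exact hle z (subset_closure hz))
    have hR : qt = C (b w) * q := by
      apply Polynomial.eq_of_infinite_eval_eq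
      refine Set.Infinite.mono (s := Metric.ball (0 : ℂ) 1) ?_ ?_
      · intro z hz
        have := key hz
        have hz : ‖z‖ < 1 := by simpa using hz
        simp only [hb, Function.const] at this
        rw [div_eq_iff (h.nz z hz.le)] at this
        simpa [hb] using this
      · exact infinite_of_mem_nhds (0 : ℂ) (Metric.ball_mem_nhds _ one_pos)
    apply h.deriv_ne (w := 1) (by simp)
    rw [hR]; simp; ring

lemma Slice.roots (h : Slice n c q qt) {a : ℂ} (ha : ‖a‖ = 1) :
    (∀ w, (qt - C a * q).eval w = 0 → ‖w‖ = 1) ∧ (qt - C a * q).natDegree = n ∧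
      (qt - C a * q).roots.Nodup ∧ (qt - C a * q) ≠ 0 := by
  have hcirc : ∀ w, (qt - C a * q).eval w = 0 → ‖w‖ = 1 := by
    intro w hw
    have e : ‖qt.eval w‖ = ‖q.eval w‖ := by
      have : qt.eval w = a * q.eval w := by
        simpa [sub_eq_zero] using hw
      rw [this, norm_mul, ha, one_mul]
    rcases lt_trichotomy ‖w‖ 1 with h1 | h1 | h1
    · exact absurd e (h.norm_disk h1).ne
    · exact h1
    · exfalso
      have hw0 : w ≠ 0 := by rintro rfl; simp at h1; linarith
      set v := ((starRingEnd ℂ) w)⁻¹ with hv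
      have hv0 : v ≠ 0 := by simpa [hv] using hw0
      have hvn : ‖v‖ = ‖w‖⁻¹ := by rw [hv, norm_inv, RCLike.norm_conj]
      have hv1 : ‖v‖ < 1 := by rw [hvn]; exact inv_lt_one_of_one_lt₀ h1
      have hvv : ((starRingEnd ℂ) v)⁻¹ = w := by simp [hv]
      have e1 := congrArg norm (h.refl w hw0)
      have e2 := congrArg norm (h.refl v hv0)
      rw [← hv] at e1
      rw [hvv] at e2
      simp only [norm_mul, norm_pow, h.hc, one_mul, RCLike.norm_conj, hvn] at e1 e2
      have := h.norm_disk hv1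
      rw [e2, ← e, e1, ← mul_assoc, ← mul_pow, inv_mul_cancel₀ (by positivity)] at this
      simp at this
  have hdeg : (qt - C a * q).natDegree = n := by
    apply natDegree_eq_of_le_of_coeff_ne_zero
    · exact (natDegree_sub_le _ _).trans
        (max_le h.qt_deg_le ((natDegree_C_mul_le _ _).trans h.hq))
    · have h0 := h.norm_disk (w := 0) (by simp)
      rw [← coeff_zero_eq_eval_zero, ← coeff_zero_eq_eval_zero, h.qt_coeff_zero] at h0
      simp only [norm_mul, h.hc, one_mul, RCLike.norm_conj] at h0
      intro h1
      rw [coeff_sub, coeff_C_mul, h.qt_coeff_n, sub_eq_zero] at h1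
      have := congrArg norm h1
      simp only [norm_mul, h.hc, ha, one_mul, RCLike.norm_conj] at this
      linarith
  have hne : (qt - C a * q) ≠ 0 := by
    intro h0; rw [h0] at hdeg; have := h.hn; simp at hdeg; omega
  refine ⟨hcirc, hdeg, ?_, hne⟩
  rw [Multiset.nodup_iff_count_le_one]
  intro w
  rw [count_roots]
  by_contra hcon
  have := (one_lt_rootMultiplicity_iff_isRoot hne).1 (not_le.1 hcon)
  obtain ⟨r1, r2⟩ := this
  apply h.deriv_ne (hcirc w r1)
  have r1' : qt.eval w = a * q.eval w := by simpa [sub_eq_zero] using r1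
  have r2' : qt.derivative.eval w = a * q.derivative.eval w := by
    simpa [sub_eq_zero] using r2
  rw [r1', r2']; ring

/-- Lower bound for polynomials that are zero-free in the disk. -/
lemma zero_free_bound {P : ℂ[X]} {N : ℕ} (hP : P.natDegree ≤ N)
    (hz : ∀ w, ‖w‖ < 1 → P.eval w ≠ 0) {w0 w : ℂ} (hw0 : ‖w0‖ < 1) (hw : ‖w‖ ≤ 1) :
    ‖P.eval w‖ * ((1 - ‖w0‖) / 2) ^ N ≤ ‖P.eval w0‖ := by
  have hP0 : P ≠ 0 := by rintro rfl; exact hz 0 (by simp) (by simp)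
  have s := IsAlgClosed.splits P
  set κ := (1 - ‖w0‖) / 2 with hκ
  have hκ0 : 0 ≤ κ := by rw [hκ]; linarith
  have hκ1 : κ ≤ 1 := by rw [hκ]; linarith [norm_nonneg w0]
  have hms : ∀ t : Multiset ℂ, (∀ b ∈ t, 1 ≤ ‖b‖) →
      ‖(t.map (fun b => w - b)).prod‖ * κ ^ t.card ≤ ‖(t.map (fun b => w0 - b)).prod‖ := by
    intro t
    induction t using Multiset.induction_on with
    | empty => simp
    | cons b t ih =>
      intro ht
      have h2 := ih (fun x hx => ht x (by simp [hx]))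
      have hb := ht b (by simp)
      have h1 : ‖w - b‖ * κ ≤ ‖w0 - b‖ := by
        have a1 : ‖w - b‖ ≤ 1 + ‖b‖ := (norm_sub_le _ _).trans (by linarith)
        have a2 : ‖b‖ - ‖w0‖ ≤ ‖w0 - b‖ := by
          rw [norm_sub_rev]; exact norm_sub_norm_le _ _
        have : ‖w - b‖ * κ ≤ (1 + ‖b‖) * κ := by gcongr
        have : (1 + ‖b‖) * κ ≤ ‖b‖ - ‖w0‖ := by
          rw [hκ]; nlinarith [norm_nonneg w0]
        linarith
      simp only [Multiset.map_cons, Multiset.prod_cons, Multiset.card_cons, norm_mul, pow_succ]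
      calc _ = (‖w - b‖ * κ) * (‖(t.map (fun b => w - b)).prod‖ * κ ^ t.card) := by ring
        _ ≤ _ := by gcongr
  have := hms P.roots (by
    intro b hb
    by_contra hcon
    exact hz b (not_le.1 hcon) ((mem_roots hP0).1 hb))
  rw [s.eval_eq_prod_roots, s.eval_eq_prod_roots, norm_mul, norm_mul, mul_assoc]
  gcongr
  refine le_trans ?_ this
  gcongr ?_ * ?_
  exact pow_le_pow_of_le_one hκ0 hκ1 ((card_roots' P).trans hP)

end OneVar
section TwoVar
open Polynomial

/-- The slice `p(ζ, ·)`. -/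
def slc (ζ : ℂ) (p : MvPolynomial (Fin 2) ℂ) : ℂ[X] :=
  MvPolynomial.aeval ![C ζ, X] p

lemma eval_slc (ζ w : ℂ) (p : MvPolynomial (Fin 2) ℂ) : (slc ζ p).eval w = ev p (ζ, w) := by
  unfold slc ev
  induction p using MvPolynomial.induction_on with
  | C a => simp
  | add p q hp hq => simp only [map_add, eval_add, hp, hq]
  | mul_X p i hp =>
    simp only [map_mul, eval_mul, hp, MvPolynomial.aeval_X, MvPolynomial.eval_X]
    fin_cases i <;> simp

lemma derivative_slc (ζ : ℂ) (p : MvPolynomial (Fin 2) ℂ) :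
    (slc ζ p).derivative = slc ζ (MvPolynomial.pderiv 1 p) := by
  unfold slc
  induction p using MvPolynomial.induction_on with
  | C a => simp
  | add p q hp hq => simp only [map_add, derivative_add, hp, hq]
  | mul_X p i hp =>
    simp only [map_mul, derivative_mul, hp, MvPolynomial.aeval_X, Derivation.leibniz, map_add,
      smul_eq_mul]
    fin_cases i
    · simp [MvPolynomial.pderiv_X]; ring
    · simp; ring

lemma natDegree_slc (ζ : ℂ) (p : MvPolynomial (Fin 2) ℂ) :
    (slc ζ p).natDegree ≤ MvPolynomial.degreeOf 1 p := by
  unfold slc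
  rw [MvPolynomial.aeval_def, MvPolynomial.eval₂_eq']
  apply natDegree_sum_le_of_forall_le
  intro d hd
  have h1 : d 1 ≤ MvPolynomial.degreeOf 1 p := MvPolynomial.monomial_le_degreeOf 1 hd
  refine le_trans ?_ h1
  simp only [Fin.prod_univ_two, Matrix.cons_val_zero, Matrix.cons_val_one, ← C_pow]
  rw [Polynomial.algebraMap_eq, ← mul_assoc, ← C_mul]
  exact natDegree_C_mul_X_pow_le _ _

lemma continuous_ev (p : MvPolynomial (Fin 2) ℂ) : Continuous (ev p) := by
  unfold ev
  refine (MvPolynomial.continuous_eval p).comp (continuous_pi ?_)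
  intro i
  fin_cases i
  · exact continuous_fst
  · exact continuous_snd

variable {m n : ℕ} {p pt : MvPolynomial (Fin 2) ℂ}

lemma nz_circle (h : IsRIF2 m n p pt) {ζ : ℂ} (hζ : ‖ζ‖ = 1)
    (hs : ¬ ∃ y : ℂ, (ζ, y) ∈ torus2 ∧ ev p (ζ, y) = 0 ∧ ev pt (ζ, y) = 0) {w : ℂ}
    (hw : ‖w‖ = 1) : ev p (ζ, w) ≠ 0 := by
  intro h0
  refine hs ⟨w, ⟨hζ, hw⟩, h0, ?_⟩
  have hζ0 : ζ ≠ 0 := by intro h0; simp [h0] at hζ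
  have hw0 : w ≠ 0 := by intro h0; simp [h0] at hw
  have := h.reflection (ζ, w) hζ0 hw0
  simp only [inv_conj_of_norm_one hζ, inv_conj_of_norm_one hw] at this
  rw [this, h0]; simp

lemma nz_closed (h : IsRIF2 m n p pt) {ζ : ℂ} (hζ : ‖ζ‖ = 1)
    (hs : ¬ ∃ y : ℂ, (ζ, y) ∈ torus2 ∧ ev p (ζ, y) = 0 ∧ ev pt (ζ, y) = 0) {w : ℂ}
    (hw : ‖w‖ ≤ 1) : ev p (ζ, w) ≠ 0 := by
  rcases hw.eq_or_lt with hw | hw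
  · exact nz_circle h hζ hs hw
  intro h0
  have hb : ∀ r : ℝ, r ∈ Set.Ioo (0 : ℝ) 1 →
      ‖ev p ((r : ℂ) * ζ, 1)‖ * ((1 - ‖w‖) / 2) ^ n ≤ ‖ev p ((r : ℂ) * ζ, w)‖ := by
    intro r hr
    rw [← eval_slc, ← eval_slc]
    refine zero_free_bound ((natDegree_slc _ _).trans h.deg2.le) ?_ hw (by simp)
    intro v hv
    rw [eval_slc]
    refine h.stable _ ⟨?_, hv⟩
    simp only [norm_mul, hζ, mul_one, Complex.norm_real, Real.norm_eq_abs, abs_of_pos hr.1]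
    exact hr.2
  have hcont : ∀ v : ℂ, Tendsto (fun r : ℝ => ‖ev p ((r : ℂ) * ζ, v)‖) (𝓝[<] (1 : ℝ))
      (𝓝 ‖ev p (ζ, v)‖) := by
    intro v
    have : Continuous (fun r : ℝ => ‖ev p ((r : ℂ) * ζ, v)‖) :=
      ((continuous_ev p).comp (by fun_prop)).norm
    have := this.tendsto 1
    simp only [Complex.ofReal_one, one_mul] at this
    exact this.mono_left nhdsWithin_le_nhds
  have hle := le_of_tendsto_of_tendsto ((hcont 1).mul_const (((1 - ‖w‖) / 2) ^ n)) (hcont w) (by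
    filter_upwards [Ioo_mem_nhdsLT (zero_lt_one' ℝ)] with r hr using hb r hr)
  rw [h0, norm_zero] at hle
  have h1 : 0 < ‖ev p (ζ, 1)‖ := norm_pos_iff.2 (nz_circle h hζ hs (by simp))
  have h2 : 0 < (1 - ‖w‖) / 2 := by linarith
  have := mul_pos h1 (pow_pos h2 n)
  linarith

lemma slice_of (h : IsRIF2 m n p pt) {ζ : ℂ} (hζ : ‖ζ‖ = 1)
    (hs : ¬ ∃ y : ℂ, (ζ, y) ∈ torus2 ∧ ev p (ζ, y) = 0 ∧ ev pt (ζ, y) = 0) :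
    Slice n (ζ ^ m) (slc ζ p) (slc ζ pt) where
  hn := h.hn
  hc := by simp [hζ]
  hq := (natDegree_slc _ _).trans h.deg2.le
  refl := by
    intro w hw
    have hζ0 : ζ ≠ 0 := by intro h0; simp [h0] at hζ
    have := h.reflection (ζ, w) hζ0 hw
    simp only [inv_conj_of_norm_one hζ] at this
    rw [eval_slc, eval_slc, this]
  nz := by
    intro w hw
    rw [eval_slc]; exact nz_closed h hζ hs hw

lemma dphi2_ne (h : IsRIF2 m n p pt) {ζ : ℂ} (hζ : ‖ζ‖ = 1)
    (hs : ¬ ∃ y : ℂ, (ζ, y) ∈ torus2 ∧ ev p (ζ, y) = 0 ∧ ev pt (ζ, y) = 0) {w : ℂ}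
    (hw : ‖w‖ = 1) : dphi2 p pt (ζ, w) ≠ 0 := by
  have := (slice_of h hζ hs).deriv_ne hw
  rw [derivative_slc, derivative_slc] at this
  simp only [eval_slc] at this
  unfold dphi2
  exact div_ne_zero this (pow_ne_zero _ (nz_circle h hζ hs hw))

lemma mem_levelSet {ζ w a : ℂ} (hζ : ‖ζ‖ = 1)
    (hnz : ‖w‖ = 1 → ev p (ζ, w) ≠ 0) :
    (ζ, w) ∈ levelSet2 p pt a ↔ ‖w‖ = 1 ∧ rif p pt (ζ, w) = a := by
  have hca : ∀ z : ℂ × ℂ, ev p z ≠ 0 → ContinuousAt (rif p pt) z := by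
    intro z hz
    exact (continuous_ev pt).continuousAt.div (continuous_ev p).continuousAt hz
  have hrad : ∀ z : ℂ × ℂ, ev p z ≠ 0 →
      Tendsto (fun r : ℝ => rif p pt ((r : ℂ) * z.1, (r : ℂ) * z.2)) (𝓝[<] (1 : ℝ))
        (𝓝 (rif p pt z)) := by
    intro z hz
    have hc : Continuous (fun r : ℝ => (((r : ℂ) * z.1, (r : ℂ) * z.2) : ℂ × ℂ)) := by fun_prop
    have h1 := hc.tendsto 1
    simp only [Complex.ofReal_one, one_mul] at h1
    exact (hca z hz).tendsto.comp (h1.mono_left nhdsWithin_le_nhds)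
  constructor
  · intro hmem
    have hclosed : IsClosed torus2 :=
      (isClosed_eq continuous_fst.norm continuous_const).inter
        (isClosed_eq continuous_snd.norm continuous_const)
    have htor : (ζ, w) ∈ torus2 :=
      closure_minimal (fun z hz => hz.1) hclosed hmem
    refine ⟨htor.2, ?_⟩
    have hp := hnz htor.2
    by_contra hne
    have hev : ∀ᶠ z in 𝓝 (ζ, w), ev p z ≠ 0 ∧ rif p pt z ≠ a :=
      ((continuous_ev p).continuousAt.eventually_ne hp).and ((hca _ hp).eventually_ne hne)
    obtain ⟨z, hz1, hz2⟩ := ((mem_closure_iff_frequently.1 hmem).and_eventually hev).exists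
    exact hz2.2 (tendsto_nhds_unique (hrad z hz2.1) hz1.2)
  · rintro ⟨hw, he⟩
    refine subset_closure ⟨⟨hζ, hw⟩, ?_⟩
    rw [← he]
    exact hrad (ζ, w) (hnz hw)

/-- Over a non-singular point, the parametrizing functions enumerate the roots. -/
lemma param_roots (h : IsRIF2 m n p pt) {ζ a : ℂ} (hζ : ‖ζ‖ = 1) (ha : ‖a‖ = 1)
    (hs : ¬ ∃ y : ℂ, (ζ, y) ∈ torus2 ∧ ev p (ζ, y) = 0 ∧ ev pt (ζ, y) = 0)
    (g : Fin n → ℂ → ℂ) {ℓ : ℕ} (τ' : Fin ℓ → ℂ)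
    (hg : levelSet2 p pt a = graphUnion n g ∪ ⋃ i, vLine (τ' i)) :
    Function.Injective (fun j => g j ζ) ∧
    (slc ζ pt - C a * slc ζ p).roots = Finset.univ.val.map (fun j => g j ζ) := by
  obtain ⟨r1, r2, r3, r4⟩ := (slice_of h hζ hs).roots ha
  set R := slc ζ pt - C a * slc ζ p with hR
  have hroot : ∀ w, w ∈ R.roots ↔ (ζ, w) ∈ levelSet2 p pt a := by
    intro w
    rw [mem_levelSet hζ (nz_circle h hζ hs), mem_roots r4]
    constructor
    · intro hw
      have hw1 := r1 w hw
      refine ⟨hw1, ?_⟩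
      have hp := nz_circle h hζ hs hw1
      unfold rif
      rw [div_eq_iff hp]
      have : R.eval w = 0 := hw
      simpa [hR, eval_slc, sub_eq_zero] using this
    · rintro ⟨hw1, hw⟩
      have hp := nz_circle h hζ hs hw1
      unfold rif at hw
      rw [div_eq_iff hp] at hw
      show R.eval w = 0
      simp [hR, eval_slc, hw]
  have hnov : ∀ i, ζ ≠ τ' i := by
    intro i hi
    have hsub : Metric.sphere (0 : ℂ) 1 ⊆ (R.roots.toFinset : Set ℂ) := by
      intro w hw
      simp only [Finset.mem_coe, Multiset.mem_toFinset]
      rw [hroot, hg]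
      exact Or.inr (Set.mem_iUnion.2 ⟨i, hi, by simpa using hw⟩)
    have hinf : (Metric.sphere (0 : ℂ) 1).Infinite := by
      have hcn : IsPreconnected (Metric.sphere (0 : ℂ) 1) :=
        isPreconnected_sphere (by simp) 0 1
      have hnt : (Metric.sphere (0 : ℂ) 1).Nontrivial :=
        ⟨1, by simp, -1, by simp, by norm_num⟩
      exact hcn.infinite_of_nontrivial hnt
    exact hinf ((Finset.finite_toSet _).subset hsub)
  have hmem : ∀ w, w ∈ R.roots ↔ ∃ j, g j ζ = w := by
    intro w
    rw [hroot, hg]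
    constructor
    · rintro (hw | hw)
      · obtain ⟨j, -, hj⟩ := Set.mem_iUnion.1 hw
        exact ⟨j, hj.symm⟩
      · obtain ⟨i, hi, -⟩ := Set.mem_iUnion.1 hw
        exact absurd hi (hnov i)
    · rintro ⟨j, hj⟩
      exact Or.inl (Set.mem_iUnion.2 ⟨j, hζ, hj.symm⟩)
  have hcard : R.roots.card = n := by
    rw [← (IsAlgClosed.splits R).natDegree_eq_card_roots, r2]
  have himg : Finset.univ.image (fun j => g j ζ) = R.roots.toFinset := by
    ext w
    rw [Multiset.mem_toFinset, hmem]
    simp only [Finset.mem_image, Finset.mem_univ, true_and]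
  have hinj : Function.Injective (fun j => g j ζ) := by
    have hci : (Finset.univ.image (fun j => g j ζ)).card = (Finset.univ : Finset (Fin n)).card := by
      rw [himg, Multiset.toFinset_card_of_nodup r3, hcard]
      simp
    have := Finset.card_image_iff.1 hci
    rwa [Finset.coe_univ, Set.injOn_univ] at this
  refine ⟨hinj, ?_⟩
  refine (Multiset.Nodup.ext r3 ?_).2 ?_
  · exact Finset.univ.nodup.map hinj
  · intro w
    rw [hmem]; simp

lemma prod_identity (h : IsRIF2 m n p pt) {ζ a : ℂ} (hζ : ‖ζ‖ = 1) (ha : ‖a‖ = 1)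
    (hs : ¬ ∃ y : ℂ, (ζ, y) ∈ torus2 ∧ ev p (ζ, y) = 0 ∧ ev pt (ζ, y) = 0)
    (g : Fin n → ℂ → ℂ) {ℓ : ℕ} (τ' : Fin ℓ → ℂ)
    (hg : levelSet2 p pt a = graphUnion n g ∪ ⋃ i, vLine (τ' i)) (w : ℂ) :
    (ev pt (ζ, w) - a * ev p (ζ, w)) * ∏ j, (0 - g j ζ) =
      (ev pt (ζ, 0) - a * ev p (ζ, 0)) * ∏ j, (w - g j ζ) := by
  have hr := (param_roots h hζ ha hs g τ' hg).2
  have e := (IsAlgClosed.splits (slc ζ pt - C a * slc ζ p)).eval_eq_prod_roots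
  have ew := e w
  have e0 := e 0
  rw [hr] at ew e0
  simp only [Multiset.map_map, eval_sub, eval_mul, eval_C, eval_slc] at ew e0
  rw [ew, e0]
  simp only [Finset.prod, Function.comp_def]
  ring

end TwoVar

/-- Let `φ = p̃/p` be a bidegree `(m,n)` RIF on `𝔻²`, let `τ₁,…,τ_K` be
the `z₁`-coordinates of the singularities of `φ` on `𝕋²`, let
`0 < ε̂ < (1/2) min_{j ≠ k} |τ_j − τ_k|`, and let
`S_ε̂ = {ζ ∈ 𝕋 : min_k |ζ − τ_k| < ε̂}`. Then for every continuous `f` on `𝕋²`, the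
function `F(ζ, α) = ∑_j f(ζ, g_j^α(ζ)) |∂φ/∂z₂(ζ, g_j^α(ζ))|⁻¹` is uniformly continuous
on `(𝕋 ∖ S_ε̂) × 𝕋`, where the `g_j^α` are the parameterizing functions for `C_α(φ)`. -/
theorem weight_sum_uniformly_continuous
    (m n : ℕ) (p pt : MvPolynomial (Fin 2) ℂ) (hRIF : IsRIF2 m n p pt)
    (K : ℕ) (τ : Fin K → ℂ)
    (hτ : ∀ x : ℂ, (∃ y : ℂ, (x, y) ∈ torus2 ∧ ev p (x, y) = 0 ∧ ev pt (x, y) = 0) ↔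
      ∃ k, x = τ k)
    (ε : ℝ) (hε : 0 < ε) (hεsmall : ∀ j k, j ≠ k → 2 * ε < ‖τ j - τ k‖)
    (G : ℂ → Fin n → ℂ → ℂ)
    (hG : ∀ a : ℂ, ‖a‖ = 1 →
      IsGraphFamily n (G a) ∧
      ∃ (ℓ : ℕ) (τ' : Fin ℓ → ℂ), (∀ i, ‖τ' i‖ = 1) ∧
        levelSet2 p pt a = graphUnion n (G a) ∪ ⋃ i, vLine (τ' i))
    (f : ℂ × ℂ → ℂ) (hf : Continuous f) :
    UniformContinuousOn
      (fun w : ℂ × ℂ =>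
        ∑ j, f (w.1, G w.2 j w.1) / (‖dphi2 p pt (w.1, G w.2 j w.1)‖ : ℂ))
      (({ζ : ℂ | ‖ζ‖ = 1} \ {ζ : ℂ | ‖ζ‖ = 1 ∧ ∃ k, ‖ζ - τ k‖ < ε}) ×ˢ
        {a : ℂ | ‖a‖ = 1}) := by
  have hns : ∀ ζ : ℂ, (∀ k, ε ≤ ‖ζ - τ k‖) →
      ¬ ∃ y : ℂ, (ζ, y) ∈ torus2 ∧ ev p (ζ, y) = 0 ∧ ev pt (ζ, y) = 0 := by
    intro ζ hζ hcon
    obtain ⟨k, hk⟩ := (hτ ζ).1 hcon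
    have := hζ k
    rw [hk, sub_self, norm_zero] at this
    linarith
  set X : Set (ℂ × ℂ) := {ζ : ℂ | ‖ζ‖ = 1 ∧ ∀ k, ε ≤ ‖ζ - τ k‖} ×ˢ {a : ℂ | ‖a‖ = 1} with hX
  have hXe : (({ζ : ℂ | ‖ζ‖ = 1} \ {ζ : ℂ | ‖ζ‖ = 1 ∧ ∃ k, ‖ζ - τ k‖ < ε}) ×ˢ
        {a : ℂ | ‖a‖ = 1}) = X := by
    rw [hX]
    congr 1
    ext ζ
    simp only [Set.mem_diff, Set.mem_setOf_eq, not_and, not_exists, not_lt]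
    tauto
  rw [hXe]
  have hsph : {a : ℂ | ‖a‖ = 1} = Metric.sphere (0 : ℂ) 1 := by ext; simp
  have hXc : IsCompact X := by
    refine IsCompact.prod ?_ ?_
    · have : {ζ : ℂ | ‖ζ‖ = 1 ∧ ∀ k, ε ≤ ‖ζ - τ k‖}
          = Metric.sphere (0 : ℂ) 1 ∩ ⋂ k, {ζ : ℂ | ε ≤ ‖ζ - τ k‖} := by
        ext; simp
      rw [this]
      refine (isCompact_sphere _ _).inter_right (isClosed_iInter fun k => ?_)
      exact isClosed_le continuous_const (by fun_prop)
    · rw [hsph]; exact isCompact_sphere _ _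
  apply hXc.uniformContinuousOn_of_continuous
  rintro ⟨ζ₀, a₀⟩ ⟨⟨hζ₀, hε₀⟩, ha₀⟩
  have hζ₀ : ‖ζ₀‖ = 1 := hζ₀
  have ha₀ : ‖a₀‖ = 1 := ha₀
  have hs₀ := hns ζ₀ hε₀
  rw [ContinuousWithinAt, tendsto_iff_ultrafilter]
  intro u hu
  have huX : ∀ᶠ x in (u : Filter (ℂ × ℂ)), x ∈ X :=
    hu (self_mem_nhdsWithin)
  have hun : (u : Filter (ℂ × ℂ)) ≤ 𝓝 (ζ₀, a₀) := hu.trans nhdsWithin_le_nhds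
  have hlim : ∀ j, ∃ y : ℂ, ‖y‖ = 1 ∧
      Tendsto (fun x : ℂ × ℂ => G x.2 j x.1) u (𝓝 y) := by
    intro j
    obtain ⟨y, hy, hy'⟩ := (isCompact_sphere (0 : ℂ) 1).ultrafilter_le_nhds
      (u.map (fun x : ℂ × ℂ => G x.2 j x.1)) (by
        rw [le_principal_iff]
        show ∀ᶠ x in (u : Filter (ℂ × ℂ)), _
        filter_upwards [huX] with x hx
        have := (hG x.2 hx.2).1.1 j x.1 hx.1.1
        simpa using this)
    exact ⟨y, by simpa using hy, hy'⟩
  choose y hy1 hy2 using hlim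
  have ht1 : Tendsto (fun x : ℂ × ℂ => x.1) u (𝓝 ζ₀) :=
    (continuous_fst.tendsto (ζ₀, a₀)).mono_left hun
  have ht2 : Tendsto (fun x : ℂ × ℂ => x.2) u (𝓝 a₀) :=
    (continuous_snd.tendsto (ζ₀, a₀)).mono_left hun
  have hev : ∀ (P : MvPolynomial (Fin 2) ℂ) (w : ℂ),
      Tendsto (fun x : ℂ × ℂ => ev P (x.1, w)) u (𝓝 (ev P (ζ₀, w))) := by
    intro P w
    exact ((continuous_ev P).tendsto _).comp (ht1.prodMk_nhds tendsto_const_nhds)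
  have hid : ∀ w : ℂ, (ev pt (ζ₀, w) - a₀ * ev p (ζ₀, w)) * ∏ j, (0 - y j) =
      (ev pt (ζ₀, 0) - a₀ * ev p (ζ₀, 0)) * ∏ j, (w - y j) := by
    intro w
    have l1 : ∀ v v' : ℂ, Tendsto (fun x : ℂ × ℂ =>
        (ev pt (x.1, v) - x.2 * ev p (x.1, v)) * ∏ j, (v' - G x.2 j x.1)) u
        (𝓝 ((ev pt (ζ₀, v) - a₀ * ev p (ζ₀, v)) * ∏ j, (v' - y j))) := by
      intro v v'
      exact ((hev pt v).sub (ht2.mul (hev p v))).mul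
        (tendsto_finsetProd _ fun j _ => tendsto_const_nhds.sub (hy2 j))
    refine tendsto_nhds_unique_of_eventuallyEq (l1 w 0) (l1 0 w) ?_
    filter_upwards [huX] with x hx
    obtain ⟨ℓ, τ', -, hl⟩ := (hG x.2 hx.2).2
    exact prod_identity hRIF hx.1.1 hx.2 (hns _ hx.1.2) (G x.2) τ' hl w
  obtain ⟨ℓ, τ', -, hl⟩ := (hG a₀ ha₀).2
  obtain ⟨hinj, hroots⟩ := param_roots hRIF hζ₀ ha₀ hs₀ (G a₀) τ' hl
  obtain ⟨r1, -, -, r4⟩ := (slice_of hRIF hζ₀ hs₀).roots ha₀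
  have hR0 : ev pt (ζ₀, 0) - a₀ * ev p (ζ₀, 0) ≠ 0 := by
    intro h0
    have := r1 0 (by simpa [eval_slc] using h0)
    simp at this
  have hsurj : ∀ j, ∃ i, y i = G a₀ j ζ₀ := by
    intro j
    have hm : G a₀ j ζ₀ ∈
        (slc ζ₀ pt - Polynomial.C a₀ * slc ζ₀ p).roots := by
      rw [hroots]; simp
    have hm := (Polynomial.mem_roots r4).1 hm
    have hm : ev pt (ζ₀, G a₀ j ζ₀) - a₀ * ev p (ζ₀, G a₀ j ζ₀) = 0 := by
      simpa [eval_slc] using hm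
    have := hid (G a₀ j ζ₀)
    rw [hm, zero_mul] at this
    have := (mul_eq_zero.1 this.symm).resolve_left hR0
    obtain ⟨i, -, hi⟩ := Finset.prod_eq_zero_iff.1 this
    exact ⟨i, (sub_eq_zero.1 hi).symm⟩
  choose σ hσ using hsurj
  have hσi : Function.Injective σ := by
    intro j k hjk
    apply hinj
    show G a₀ j ζ₀ = G a₀ k ζ₀
    rw [← hσ, ← hσ, hjk]
  have hσb : Function.Bijective σ := Finite.injective_iff_bijective.1 hσi
  have hsum : ∑ j, f (ζ₀, G a₀ j ζ₀) / (‖dphi2 p pt (ζ₀, G a₀ j ζ₀)‖ : ℂ)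
      = ∑ i, f (ζ₀, y i) / (‖dphi2 p pt (ζ₀, y i)‖ : ℂ) := by
    refine Fintype.sum_bijective σ hσb _ _ ?_
    intro j
    rw [hσ]
  show Tendsto _ _ (𝓝 (∑ j, f (ζ₀, G a₀ j ζ₀) / (‖dphi2 p pt (ζ₀, G a₀ j ζ₀)‖ : ℂ)))
  rw [hsum]
  refine tendsto_finsetSum _ fun j _ => ?_
  have hpt : Tendsto (fun x : ℂ × ℂ => (x.1, G x.2 j x.1)) u (𝓝 (ζ₀, y j)) :=
    ht1.prodMk_nhds (hy2 j)
  have hpn := nz_circle hRIF hζ₀ hs₀ (hy1 j)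
  have hdn := dphi2_ne hRIF hζ₀ hs₀ (hy1 j)
  have hdc : ContinuousAt (dphi2 p pt) (ζ₀, y j) := by
    unfold dphi2
    refine ContinuousAt.div ?_ ((continuous_ev p).pow 2).continuousAt (pow_ne_zero _ hpn)
    exact (((continuous_ev _).mul (continuous_ev _)).sub
      ((continuous_ev _).mul (continuous_ev _))).continuousAt
  have hc : ContinuousAt (fun z : ℂ × ℂ => f z / (‖dphi2 p pt z‖ : ℂ)) (ζ₀, y j) := by
    refine hf.continuousAt.div (Complex.continuous_ofReal.continuousAt.comp hdc.norm) ?_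
    simpa using hdn
  exact hc.tendsto.comp hpt
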